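/- Let P be a simple polygon and let Π be a connected curve contained in P. If every point of the boundary ∂P is visible from some point of Π, then every point of P is visible from some point of Π. -/

import Mathlib

open Set

noncomputable section

/-- The Euclidean plane. -/
abbrev E2 := EuclideanSpace ℝ (Fin 2)

/-- A simple polygon in the plane, given by its cyclic sequence of vertices.
Adjacent edges meet exactly at their common vertex, and non-adjacent edges
are disjoint, so the boundary is a simple closed polygonal curve. -/
structure SimplePolygon where
  n : ℕ
  three_le : 3 ≤ n
  vtx : ZMod n → E2
  inj : Function.Injective vtx
  adj_edges : ∀ i : ZMod n,
    segment ℝ (vtx i) (vtx (i + 1)) ∩ segment ℝ (vtx (i + 1)) (vtx (i + 2)) = {vtx (i + 1)}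
  nonadj_edges : ∀ i j : ZMod n, i ≠ j → i + 1 ≠ j → j + 1 ≠ i →
    segment ℝ (vtx i) (vtx (i + 1)) ∩ segment ℝ (vtx j) (vtx (j + 1)) = ∅

namespace SimplePolygon

variable (P : SimplePolygon)

/-- The boundary `∂P`: the union of the edges. -/
def boundary : Set E2 := ⋃ i : ZMod P.n, segment ℝ (P.vtx i) (P.vtx (i + 1))

/-- The compact region bounded by `∂P`: the boundary together with all points of the
bounded connected components of its complement. -/
def region : Set E2 :=
  P.boundary ∪ {x | x ∉ P.boundary ∧ Bornology.IsBounded (connectedComponentIn P.boundaryᶜ x)}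

/-- `x` sees `y` (in `P`) if the closed segment `[x,y]` is contained in `P`. -/
def Visible (x y : E2) : Prop := segment ℝ x y ⊆ P.region

/-- The vertex `vtx i` is reflex: its internal angle is strictly larger than `π`, i.e.
near the vertex the midpoint of two points at equal small parameter along the two
incident edges lies outside the region. -/
def IsReflex (i : ZMod P.n) : Prop :=
  ∃ ε₀ > (0 : ℝ), ∀ ε ∈ Set.Ioo (0 : ℝ) ε₀,
    midpoint ℝ (P.vtx i + ε • (P.vtx (i - 1) - P.vtx i))
               (P.vtx i + ε • (P.vtx (i + 1) - P.vtx i)) ∉ P.region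

/-- `P` is star-shaped if a single point of `P` sees all of `P`. -/
def IsStarShaped : Prop := ∃ x ∈ P.region, ∀ y ∈ P.region, P.Visible x y

/-- A visibility path: a connected curve inside `P` from which every point of `P`
is visible. -/
def IsVisibilityPath (Pth : Set E2) : Prop :=
  IsConnected Pth ∧ Pth ⊆ P.region ∧ ∀ x ∈ P.region, ∃ p ∈ Pth, P.Visible x p

/-- The pocket, inside `P`, determined by a cut segment `s` on the side of the point `u`:
the closure of the connected component of `P \ s` containing `u`, together with `s`. -/
def pocketOfSeg (s : Set E2) (u : E2) : Set E2 :=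
  closure (connectedComponentIn (P.region \ s) u) ∪ s

end SimplePolygon

/-- A cut of a simple polygon `P`: for a reflex vertex `v = vtx i` with adjacent
vertex `u = vtx j`, the segment from `v` to the closest point `w` of `∂P` hit by
the ray from `v` in the direction from `u` to `v`. -/
structure SimplePolygon.Cut (P : SimplePolygon) where
  i : ZMod P.n
  j : ZMod P.n
  adj : j = i + 1 ∨ j = i - 1
  reflex : P.IsReflex i
  t : ℝ
  t_pos : 0 < t
  hits : P.vtx i + t • (P.vtx i - P.vtx j) ∈ P.boundary
  first_hit : ∀ s ∈ Set.Ioo (0 : ℝ) t, P.vtx i + s • (P.vtx i - P.vtx j) ∉ P.boundary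
  inside : segment ℝ (P.vtx i) (P.vtx i + t • (P.vtx i - P.vtx j)) ⊆ P.region

namespace SimplePolygon.Cut

variable {P : SimplePolygon} (C : P.Cut)

/-- The reflex vertex generating the cut. -/
def v : E2 := P.vtx C.i

/-- The adjacent vertex `u`; the edge `u v` is the generator of the cut. -/
def u : E2 := P.vtx C.j

/-- The other endpoint of the cut, on `∂P`. -/
def w : E2 := P.vtx C.i + C.t • (P.vtx C.i - P.vtx C.j)

/-- The cut as a segment. -/
def seg : Set E2 := segment ℝ C.v C.w

/-- `Pocket(C)`: the part of `P` cut off by `C` that contains the generator vertex `u`. -/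
def pocket : Set E2 := P.pocketOfSeg C.seg C.u

/-- A cut is redundant if the pocket of some cut is strictly contained in its pocket. -/
def Redundant : Prop := ∃ C' : P.Cut, C'.pocket ⊂ C.pocket

/-- A nonredundant (essential) cut. -/
def Nonredundant : Prop := ¬ C.Redundant

/-- `x` is a vertex of the polygon `Pocket(C)`: either the endpoint `w` of the cut, or a
vertex of `P` belonging to the pocket. -/
def PocketVertex (x : E2) : Prop :=
  x = C.w ∨ ∃ k : ZMod P.n, P.vtx k = x ∧ x ∈ C.pocket

end SimplePolygon.Cut

/-- Length of a polygonal path given by its list of vertices. -/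
def polyLength (l : List E2) : ℝ := ((l.zip l.tail).map fun p => dist p.1 p.2).sum

namespace SimplePolygon

variable (P : SimplePolygon)

/-- A polygonal path inside `P`: a nonempty list of points with each consecutive
segment contained in `P`. -/
def IsPolyPathIn (l : List E2) : Prop :=
  l ≠ [] ∧ List.Chain' (fun a b => segment ℝ a b ⊆ P.region) l

/-- `l` is a shortest Euclidean (polygonal) path inside `P` from `x` to the set `S`. -/
def IsGeodesicTo (x : E2) (S : Set E2) (l : List E2) : Prop :=
  P.IsPolyPathIn l ∧ l.head? = some x ∧ (∃ y ∈ S, l.getLast? = some y) ∧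
  ∀ m : List E2, P.IsPolyPathIn m → m.head? = some x →
    (∃ y ∈ S, m.getLast? = some y) → polyLength l ≤ polyLength m

/-- The subpolygon `Q` of `P` obtained by cutting `P` along all nonredundant cuts:
the closure of `P` minus the union of the pockets of all nonredundant cuts. -/
def core : Set E2 :=
  closure (P.region \ ⋃ C : {C : P.Cut // C.Nonredundant}, (C : P.Cut).pocket)

end SimplePolygon

/-- The planar cross product. -/
def cross2 (a b : E2) : ℝ := a 0 * b 1 - a 1 * b 0

/-- A polygonal chain all of whose turns have the sign `s` (a convex chain bending
consistently to one side). -/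
def ConvexChain (s : ℝ) (l : List E2) : Prop :=
  ∀ p q r : E2, [p, q, r] <:+: l → 0 ≤ s * cross2 (q - p) (r - q)

/-- Two continuous logarithms of the same function on a preconnected set differ by a constant. -/
theorem sub_eq_sub_of_exp_eq {X : Type*} [TopologicalSpace X] {s : Set X}
    (hs : IsPreconnected s) {f g : X → ℂ}
    (hf : ContinuousOn f s) (hg : ContinuousOn g s)
    (h : ∀ z ∈ s, Complex.exp (f z) = Complex.exp (g z)) {z w : X} (hz : z ∈ s) (hw : w ∈ s) :
    f z - g z = f w - g w := by
  have hex : ∀ z : s, ∃ n : ℤ, f z = g z + n * (2 * Real.pi * Complex.I) := fun z =>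
    Complex.exp_eq_exp_iff_exists_int.1 (h z z.2)
  choose n hn using hex
  have hpi : (2 * Real.pi * Complex.I : ℂ) ≠ 0 := Complex.two_pi_I_ne_zero
  have hcast : ∀ z : s, ((n z : ℝ)) = ((f z - g z) / (2 * Real.pi * Complex.I)).re := by
    intro z
    rw [hn z, add_sub_cancel_left, mul_div_assoc, div_self hpi]
    simp
  have hcont : Continuous fun z : s => (n z : ℝ) := by
    simp_rw [hcast]
    have := (hf.sub hg).domRestrict
    exact Complex.continuous_re.comp (this.div_const _)
  have hn_cont : Continuous n := Int.isClosedEmbedding_coe_real.isInducing.continuous_iff.2 hcont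
  have : PreconnectedSpace s := Subtype.preconnectedSpace hs
  have hconst := PreconnectedSpace.constant inferInstance hn_cont (x := ⟨z, hz⟩) (y := ⟨w, hw⟩)
  have h1 := hn ⟨z, hz⟩
  have h2 := hn ⟨w, hw⟩
  simp only at h1 h2
  rw [h1, h2, hconst]
  ring

/-- A compact plane set with connected complement carries a logarithm of `z - w` for every `w`
outside it. -/
theorem exists_continuousOn_log_sub {K : Set ℂ} (hK : IsCompact K) (hKc : IsPreconnected Kᶜ)
    {w : ℂ} (hw : w ∉ K) :
    ∃ f : ℂ → ℂ, ContinuousOn f K ∧ ∀ z ∈ K, Complex.exp (f z) = z - w := by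
  obtain ⟨R, hR⟩ := hK.isBounded.exists_norm_le
  let v : ℂ := ((max R 0 + 1 : ℝ) : ℂ)
  have hv : ‖v‖ = max R 0 + 1 := by
    rw [Complex.norm_real, Real.norm_of_nonneg]; positivity
  have hlt : ∀ z ∈ K, ‖z‖ < ‖v‖ := fun z hz => by
    have := hR z hz; have := le_max_left R 0; linarith
  have hv0 : v ≠ 0 := norm_pos_iff.1 (by rw [hv]; positivity)
  have hvK : v ∈ Kᶜ := fun h => lt_irrefl _ (hlt v h)
  have key : ∃ f : ℂ → ℂ, ContinuousOn f K ∧ ∀ z ∈ K, Complex.exp (f z) = (z - w) / (z - v) := by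
    refine hKc.induction₂ (fun a b => ∃ f : ℂ → ℂ, ContinuousOn f K ∧
      ∀ z ∈ K, Complex.exp (f z) = (z - a) / (z - b)) ?_ ?_ ?_ hw hvK
    · intro a ha
      obtain ⟨ε, hε, hball⟩ := Metric.isOpen_iff.1 hK.isClosed.isOpen_compl a ha
      filter_upwards [nhdsWithin_le_nhds (Metric.ball_mem_nhds a (half_pos hε)),
        self_mem_nhdsWithin] with b hb hbK
      have hne : ∀ z ∈ K, z - b ≠ 0 := fun z hz h => hbK (by rwa [← sub_eq_zero.1 h])
      have hslit : ∀ z ∈ K, (z - a) / (z - b) ∈ Complex.slitPlane := by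
        intro z hz
        have h1 : (z - a) / (z - b) = 1 + (b - a) / (z - b) := by
          field_simp [hne z hz]; ring
        rw [h1]
        apply Complex.mem_slitPlane_of_norm_lt_one
        rw [norm_div, div_lt_one (norm_pos_iff.2 (hne z hz))]
        have h2 : ε ≤ dist z a := by
          by_contra! h
          exact hball h hz
        have h3 := dist_triangle z b a
        rw [Metric.mem_ball] at hb
        rw [← dist_eq_norm, ← dist_eq_norm]
        linarith
      refine ⟨fun z => Complex.log ((z - a) / (z - b)), ?_, fun z hz =>
        Complex.exp_log (Complex.slitPlane_ne_zero (hslit z hz))⟩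
      exact ContinuousOn.clog (by fun_prop (disch := exact hne)) hslit
    · rintro a b c - hb - ⟨f, hf, hf'⟩ ⟨g, hg, hg'⟩
      refine ⟨fun z => f z + g z, hf.add hg, fun z hz => ?_⟩
      have : z - b ≠ 0 := fun h => hb (by rwa [← sub_eq_zero.1 h])
      rw [Complex.exp_add, hf' z hz, hg' z hz, div_mul_div_cancel₀ this]
    · rintro a b - - ⟨f, hf, hf'⟩
      exact ⟨fun z => -f z, hf.neg, fun z hz => by rw [Complex.exp_neg, hf' z hz, inv_div]⟩
  obtain ⟨f, hf, hf'⟩ := key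
  have hslit : ∀ z ∈ K, 1 + -(z / v) ∈ Complex.slitPlane := fun z hz => by
    apply Complex.mem_slitPlane_of_norm_lt_one
    rw [norm_neg, norm_div, div_lt_one (norm_pos_iff.2 hv0)]
    exact hlt z hz
  refine ⟨fun z => f z + (Complex.log (1 + -(z / v)) + Complex.log (-v)), ?_, fun z hz => ?_⟩
  · exact hf.add ((ContinuousOn.clog (by fun_prop) hslit).add continuousOn_const)
  · have : z - v ≠ 0 := fun h => hvK (by rwa [← sub_eq_zero.1 h])
    rw [Complex.exp_add, Complex.exp_add, hf' z hz,
      Complex.exp_log (Complex.slitPlane_ne_zero (hslit z hz)), Complex.exp_log (neg_ne_zero.2 hv0)]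
    field_simp
    ring

/-- The slit set `K \ [x, w]`, with `w` outside `K`, carries a logarithm of `z - x`. -/
theorem exists_continuousOn_log_sub_slit {K : Set ℂ} (hK : IsCompact K) (hKc : IsPreconnected Kᶜ)
    (x : ℂ) {w : ℂ} (hw : w ∉ K) :
    ∃ f : ℂ → ℂ, ContinuousOn f (K \ segment ℝ x w) ∧
      ∀ z ∈ K \ segment ℝ x w, Complex.exp (f z) = z - x := by
  obtain ⟨f, hf, hf'⟩ := exists_continuousOn_log_sub hK hKc hw
  have hne : ∀ z ∈ K \ segment ℝ x w, z - w ≠ 0 := fun z hz h =>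
    hw (by rw [← sub_eq_zero.1 h]; exact hz.1)
  have hslit : ∀ z ∈ K \ segment ℝ x w, (z - x) / (z - w) ∈ Complex.slitPlane := by
    intro z hz
    rw [Complex.mem_slitPlane_iff_not_le_zero]
    intro hle
    obtain ⟨hre, him⟩ := Complex.le_def.1 hle
    set c := (z - x) / (z - w) with hc
    have hcr : c = ((c.re : ℝ) : ℂ) := Complex.ext (by simp) (by simpa using him)
    have hmul : z - x = (c.re : ℂ) * (z - w) := by
      rw [← hcr, hc, div_mul_cancel₀ _ (hne z hz)]
    have hre' : c.re ≤ 0 := hre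
    have hpos : 0 < 1 - c.re := by linarith
    apply hz.2
    refine ⟨1 / (1 - c.re), -c.re / (1 - c.re), by positivity,
      div_nonneg (by linarith) hpos.le, by field_simp; ring, ?_⟩
    have hC : (1 - c.re : ℂ) ≠ 0 := by exact_mod_cast hpos.ne'
    simp only [Complex.real_smul]
    push_cast
    field_simp
    linear_combination -hmul
  refine ⟨fun z => f z + Complex.log ((z - x) / (z - w)), ?_, fun z hz => ?_⟩
  · exact (hf.mono sdiff_subset).add
      (ContinuousOn.clog (by fun_prop (disch := exact hne)) hslit)
  · rw [Complex.exp_add, hf' z hz.1, Complex.exp_log (Complex.slitPlane_ne_zero (hslit z hz)),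
      mul_div_cancel₀ _ (hne z hz)]

theorem mem_segment_add_smul {E : Type*} [AddCommGroup E] [Module ℝ E] {x u z : E} {T : ℝ}
    (hT : 0 ≤ T) :
    z ∈ segment ℝ x (x + T • u) ↔ ∃ t : ℝ, 0 ≤ t ∧ t ≤ T ∧ z = x + t • u := by
  rw [segment_eq_image']
  constructor
  · rintro ⟨a, ⟨ha0, ha1⟩, rfl⟩
    exact ⟨a * T, mul_nonneg ha0 hT, mul_le_of_le_one_left hT ha1, by simp [mul_smul]⟩
  · rintro ⟨t, ht0, htT, rfl⟩
    rcases hT.eq_or_lt with rfl | hT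
    · have : t = 0 := le_antisymm htT ht0
      exact ⟨0, by simp, by simp [this]⟩
    · refine ⟨t / T, ⟨by positivity, (div_le_one hT).2 htT⟩, ?_⟩
      simp [smul_smul, div_mul_cancel₀ t (ne_of_gt hT)]

/-- A slit set `K \ [x, w]`, with `w` outside `K` in direction `θ` from `x`, carries a logarithm of
`z - x` whose imaginary part near `x` is the polar angle in `(θ, θ + 2π)`. -/
theorem exists_normalized_log_slit {K : Set ℂ} (hK : IsCompact K) (hKc : IsPreconnected Kᶜ)
    {x : ℂ} {r s : ℝ} (hs : 0 < s) (hsr : s < r) (hball : Metric.ball x r ⊆ K) (θ : ℝ) {T : ℝ}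
    (hT : 0 < T) (hw : x + T • Complex.exp (θ * Complex.I) ∉ K) :
    ∃ f : ℂ → ℂ,
      ContinuousOn f (K \ segment ℝ x (x + T • Complex.exp (θ * Complex.I))) ∧
      (∀ z ∈ K \ segment ℝ x (x + T • Complex.exp (θ * Complex.I)), Complex.exp (f z) = z - x) ∧
      ∀ φ ∈ Ioo θ (θ + 2 * Real.pi),
        f (x + s • Complex.exp (φ * Complex.I)) = Real.log s + φ * Complex.I := by
  obtain ⟨f, hf, hf'⟩ := exists_continuousOn_log_sub_slit hK hKc x hw
  have hmaps : ∀ φ ∈ Ioo θ (θ + 2 * Real.pi), x + s • Complex.exp (φ * Complex.I) ∈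
      K \ segment ℝ x (x + T • Complex.exp (θ * Complex.I)) := by
    rintro φ ⟨h1, h2⟩
    refine ⟨hball ?_, fun hmem => ?_⟩
    · rw [mem_ball_iff_norm, add_sub_cancel_left, norm_smul, Complex.norm_exp_ofReal_mul_I,
        Real.norm_of_nonneg hs.le]
      linarith
    · obtain ⟨t, ht0, -, ht⟩ := (mem_segment_add_smul hT.le).1 hmem
      have heq := add_left_cancel ht
      have hst : s = t := by
        have := congrArg norm heq
        simpa only [norm_smul, Complex.norm_exp_ofReal_mul_I, mul_one,
          Real.norm_of_nonneg hs.le, Real.norm_of_nonneg ht0] using this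
      subst hst
      have hexp := smul_right_injective ℂ hs.ne' heq
      obtain ⟨n, hn⟩ := Complex.exp_eq_exp_iff_exists_int.1 hexp
      have hn' : φ = θ + n * (2 * Real.pi) := by
        have := congrArg Complex.im hn
        simpa using this
      have hp := Real.two_pi_pos
      have hn0 : (0 : ℝ) < n := by
        by_contra! hle
        nlinarith
      have hn1 : (n : ℝ) < 1 := by
        by_contra! hle
        nlinarith
      have : 0 < n := by exact_mod_cast hn0
      have : n < 1 := by exact_mod_cast hn1
      omega
  have hexp : ∀ φ : ℝ, Complex.exp (Real.log s + φ * Complex.I) =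
      s • Complex.exp (φ * Complex.I) := fun φ => by
    rw [Complex.exp_add, ← Complex.ofReal_exp, Real.exp_log hs, Complex.real_smul]
  set g : ℝ → ℂ := fun φ => f (x + s • Complex.exp (φ * Complex.I)) with hg
  have hmid : θ + Real.pi ∈ Ioo θ (θ + 2 * Real.pi) :=
    ⟨by linarith [Real.pi_pos], by linarith [Real.pi_pos]⟩
  have hconst : ∀ φ ∈ Ioo θ (θ + 2 * Real.pi), g φ - (Real.log s + φ * Complex.I) =
      g (θ + Real.pi) - (Real.log s + ((θ + Real.pi : ℝ) : ℂ) * Complex.I) := by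
    intro φ hφ
    refine sub_eq_sub_of_exp_eq (g := fun φ : ℝ => (Real.log s + φ * Complex.I : ℂ))
      isPreconnected_Ioo (hf.comp (by fun_prop) hmaps) (by fun_prop)
      (fun φ hφ => ?_) hφ hmid
    rw [Function.comp_apply, hexp, hf' _ (hmaps φ hφ), add_sub_cancel_left]
  refine ⟨fun z => f z - (g (θ + Real.pi) -
    (Real.log s + ((θ + Real.pi : ℝ) : ℂ) * Complex.I)), hf.sub continuousOn_const, ?_, ?_⟩
  · intro z hz
    rw [Complex.exp_sub, hf' z hz, Complex.exp_sub, hexp, hg]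
    simp only
    rw [hf' _ (hmaps _ hmid), add_sub_cancel_left, div_self, div_one]
    exact smul_ne_zero hs.ne' (Complex.exp_ne_zero _)
  · intro φ hφ
    have := hconst φ hφ
    simp only [hg] at this ⊢
    linear_combination this

/-- A segment path `start → b → q` leaving `x` in direction `θ + π` stays off the closed rays from
`x` in all directions close to `θ`, unless `x` lies on the last segment. -/
theorem eventually_disjoint_ray {x q : ℂ} {θ s t : ℝ} (hs : 0 < s) (hst : s ≤ t)
    (hx : x ∉ segment ℝ (x + t • Complex.exp ((θ + Real.pi : ℝ) * Complex.I)) q) :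
    ∀ᶠ θ' : ℝ in nhds θ, ∀ τ : ℝ, 0 ≤ τ → x + τ • Complex.exp (θ' * Complex.I) ∉
      segment ℝ (x + s • Complex.exp ((θ + Real.pi : ℝ) * Complex.I))
        (x + t • Complex.exp ((θ + Real.pi : ℝ) * Complex.I)) ∪
      segment ℝ (x + t • Complex.exp ((θ + Real.pi : ℝ) * Complex.I)) q := by
  set u := Complex.exp (θ * Complex.I) with hu
  have hu' : Complex.exp ((θ + Real.pi : ℝ) * Complex.I) = -u := by
    push_cast
    rw [add_mul, Complex.exp_add, Complex.exp_pi_mul_I, mul_neg_one]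
  rw [hu'] at hx ⊢
  have hu0 : u ≠ 0 := Complex.exp_ne_zero _
  have ht : 0 < t := hs.trans_le hst
  set A := segment ℝ (x + s • -u) (x + t • -u) ∪ segment ℝ (x + t • -u) q with hA
  have hAcomp : IsCompact A := by
    rw [hA]
    simp only [← convexHull_pair]
    exact (Set.Finite.isCompact_convexHull (𝕜 := ℝ) (by simp)).union
      (Set.Finite.isCompact_convexHull (𝕜 := ℝ) (by simp))
  have hfirst : ∀ z ∈ segment ℝ (x + s • -u) (x + t • -u),
      ∃ τ : ℝ, 0 < τ ∧ z = x + τ • -u := by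
    rintro z ⟨a, b, ha, hb, hab, rfl⟩
    refine ⟨a * s + b * t, ?_, ?_⟩
    · nlinarith
    · have : a • x + b • x = x := by rw [← add_smul, hab, one_smul]
      nth_rewrite 3 [← this]
      module
  have hray : ∀ τ : ℝ, 0 ≤ τ → x + τ • u ∉ A := by
    rintro τ hτ (h | h)
    · obtain ⟨σ, hσ, hz⟩ := hfirst _ h
      have h1 : (τ + σ) • u = 0 := by
        have := add_left_cancel hz
        rw [add_smul, this]; module
      rcases smul_eq_zero.1 h1 with h2 | h2
      · linarith
      · exact hu0 h2
    · apply hx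
      refine (convex_segment _ _).segment_subset (left_mem_segment ℝ _ _) h ?_
      have hpos : 0 < t + τ := by linarith
      refine ⟨τ / (t + τ), t / (t + τ), by positivity, by positivity, by field_simp; ring, ?_⟩
      have h1 : τ / (t + τ) + t / (t + τ) = 1 := by field_simp; ring
      have h2 : τ / (t + τ) * t = t / (t + τ) * τ := by ring
      calc (τ / (t + τ)) • (x + t • -u) + (t / (t + τ)) • (x + τ • u)
          = (τ / (t + τ) + t / (t + τ)) • x
            + (t / (t + τ) * τ - τ / (t + τ) * t) • u := by module
        _ = x := by rw [h1, h2]; simp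
  have hxA : ∀ z ∈ A, z - x ≠ 0 := by
    intro z hz h
    have := hray 0 le_rfl
    rw [zero_smul, add_zero, ← sub_eq_zero.1 h] at this
    exact this hz
  have hF : ContinuousOn (fun z : ℂ => (z - x) / ‖z - x‖) A := by
    refine ContinuousOn.div (by fun_prop) (by fun_prop) fun z hz => ?_
    exact_mod_cast norm_ne_zero_iff.2 (hxA z hz)
  have hclosed := (hAcomp.image_of_continuousOn hF).isClosed
  have hdir : ∀ (θ' τ : ℝ), 0 ≤ τ → x + τ • Complex.exp (θ' * Complex.I) ∈ A →
      Complex.exp (θ' * Complex.I) ∈ (fun z : ℂ => (z - x) / ‖z - x‖) '' A := by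
    intro θ' τ hτ hmem
    refine ⟨_, hmem, ?_⟩
    have h0 := hxA _ hmem
    rw [add_sub_cancel_left] at h0
    have hτ0 : (τ : ℂ) ≠ 0 := by
      rintro h
      apply h0
      rw [Complex.real_smul, h, zero_mul]
    simp only [add_sub_cancel_left]
    rw [norm_smul, Complex.norm_exp_ofReal_mul_I, mul_one, Real.norm_of_nonneg hτ,
      Complex.real_smul, mul_div_cancel_left₀ _ hτ0]
  have hnot : u ∉ (fun z : ℂ => (z - x) / ‖z - x‖) '' A := by
    rintro ⟨z, hz, hzu⟩
    apply hray ‖z - x‖ (norm_nonneg _)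
    have hne : (‖z - x‖ : ℂ) ≠ 0 := by exact_mod_cast norm_ne_zero_iff.2 (hxA z hz)
    have : x + ‖z - x‖ • u = z := by
      rw [← hzu, Complex.real_smul, mul_div_cancel₀ _ hne, add_sub_cancel]
    rwa [this]
  have hcont : Continuous fun θ' : ℝ => Complex.exp (θ' * Complex.I) := by fun_prop
  filter_upwards [hcont.continuousAt.preimage_mem_nhds (hclosed.isOpen_compl.mem_nhds hnot)]
    with θ' hθ' τ hτ hmem
  exact hθ' (hdir θ' τ hτ hmem)

/-- Suppose that in every direction from `x` there is a point visible from `x` that is seen from the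
connected set `S`, and a segment from `x` leaving `K` along which `K` contains only points visible
from `x`. Then `x` is seen from `S`. -/
theorem exists_segment_subset_of_rays {K S : Set ℂ} (hK : IsCompact K) (hKc : IsPreconnected Kᶜ)
    (hS : IsConnected S) (hSK : S ⊆ K) {x : ℂ} {r : ℝ} (hr : 0 < r)
    (hball : Metric.ball x r ⊆ K)
    (hray : ∀ θ : ℝ, ∃ t T : ℝ, r ≤ t ∧ 0 < T ∧
      segment ℝ x (x + t • Complex.exp (θ * Complex.I)) ⊆ K ∧
      (∃ p ∈ S, segment ℝ (x + t • Complex.exp (θ * Complex.I)) p ⊆ K) ∧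
      x + T • Complex.exp (θ * Complex.I) ∉ K ∧
      ∀ z ∈ segment ℝ x (x + T • Complex.exp (θ * Complex.I)), z ∈ K → segment ℝ x z ⊆ K) :
    ∃ p ∈ S, segment ℝ x p ⊆ K := by
  by_contra! hno
  choose t T hrt hT hseg hsees hout hslit using hray
  have hs : 0 < r / 2 := half_pos hr
  have hsr : r / 2 < r := half_lt_self hr
  choose L hLcont hLexp hLnorm using fun θ : ℝ =>
    exists_normalized_log_slit hK hKc hs hsr hball θ (hT θ) (hout θ)
  have hSslit : ∀ θ : ℝ, S ⊆ K \ segment ℝ x (x + T θ • Complex.exp (θ * Complex.I)) :=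
    fun θ p hp => ⟨hSK hp, fun hmem => hno p hp (hslit θ p hmem (hSK hp))⟩
  have hdiff : ∀ (θ θ' : ℝ), ∀ p ∈ S, ∀ q ∈ S, L θ p - L θ' p = L θ q - L θ' q := by
    intro θ θ' p hp q hq
    refine sub_eq_sub_of_exp_eq hS.isPreconnected ((hLcont θ).mono (hSslit θ))
      ((hLcont θ').mono (hSslit θ')) (fun z hz => ?_) hp hq
    rw [hLexp θ z (hSslit θ hz), hLexp θ' z (hSslit θ' hz)]
  have hloc : ∀ θ : ℝ, ∃ q ∈ S, (∀ᶠ θ' in nhds θ, L θ' q = L θ q) ∧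
      L (θ + 2 * Real.pi) q = L θ q + 2 * Real.pi * Complex.I := by
    intro θ
    obtain ⟨q, hq, hbq⟩ := hsees (θ + Real.pi)
    set b := x + t (θ + Real.pi) • Complex.exp ((θ + Real.pi : ℝ) * Complex.I) with hb
    set a := x + (r / 2) • Complex.exp ((θ + Real.pi : ℝ) * Complex.I) with ha
    have hst : r / 2 ≤ t (θ + Real.pi) := by linarith [hrt (θ + Real.pi)]
    have hxq : x ∉ segment ℝ b q := fun h => hno q hq
      (((convex_segment b q).segment_subset h (right_mem_segment ℝ _ _)).trans hbq)
    have hev := eventually_disjoint_ray hs hst hxq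
    have hamem : a ∈ segment ℝ x b :=
      (mem_segment_add_smul (hs.le.trans hst)).2 ⟨_, hs.le, hst, rfl⟩
    have habK : segment ℝ a b ⊆ K :=
      ((convex_segment x b).segment_subset hamem (right_mem_segment ℝ _ _)).trans
        (hseg (θ + Real.pi))
    set A := segment ℝ a b ∪ segment ℝ b q with hA
    have hAK : A ⊆ K := union_subset habK hbq
    have hAconn : IsPreconnected A :=
      IsPreconnected.union b (right_mem_segment ℝ _ _) (left_mem_segment ℝ _ _)
        (convex_segment a b).isPreconnected (convex_segment b q).isPreconnected
    have haA : a ∈ A := Or.inl (left_mem_segment ℝ _ _)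
    have hqA : q ∈ A := Or.inr (right_mem_segment ℝ _ _)
    have hAslit : ∀ θ' : ℝ, (∀ τ : ℝ, 0 ≤ τ → x + τ • Complex.exp (θ' * Complex.I) ∉ A) →
        A ⊆ K \ segment ℝ x (x + T θ' • Complex.exp (θ' * Complex.I)) := by
      intro θ' h z hz
      refine ⟨hAK hz, fun hmem => ?_⟩
      obtain ⟨τ, hτ, -, rfl⟩ := (mem_segment_add_smul (hT θ').le).1 hmem
      exact h τ hτ hz
    have hcomp : ∀ θ₁ θ₂ : ℝ,
        A ⊆ K \ segment ℝ x (x + T θ₁ • Complex.exp (θ₁ * Complex.I)) →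
        A ⊆ K \ segment ℝ x (x + T θ₂ • Complex.exp (θ₂ * Complex.I)) →
        L θ₁ q - L θ₂ q = L θ₁ a - L θ₂ a := by
      intro θ₁ θ₂ h1 h2
      refine sub_eq_sub_of_exp_eq hAconn ((hLcont θ₁).mono h1) ((hLcont θ₂).mono h2)
        (fun z hz => ?_) hqA haA
      rw [hLexp θ₁ z (h1 hz), hLexp θ₂ z (h2 hz)]
    have hself := hAslit θ hev.self_of_nhds
    have hpi := Real.pi_pos
    have hLa : L θ a = Real.log (r / 2) + (θ + Real.pi : ℝ) * Complex.I :=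
      hLnorm θ (θ + Real.pi) ⟨by linarith, by linarith⟩
    refine ⟨q, hq, ?_, ?_⟩
    · filter_upwards [hev, Ioo_mem_nhds (show θ - Real.pi < θ by linarith)
        (show θ < θ + Real.pi by linarith)] with θ' h1 h2
      have h3 := hcomp θ' θ (hAslit θ' h1) hself
      have h4 : L θ' a = Real.log (r / 2) + (θ + Real.pi : ℝ) * Complex.I :=
        hLnorm θ' (θ + Real.pi) ⟨by linarith [h2.2], by linarith [h2.1]⟩
      rw [h4, hLa, sub_self] at h3
      exact sub_eq_zero.1 h3
    · have hper : ∀ φ : ℝ, Complex.exp ((φ + 2 * Real.pi : ℝ) * Complex.I) =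
          Complex.exp (φ * Complex.I) := by
        intro φ
        push_cast
        rw [add_mul, Complex.exp_add, Complex.exp_two_pi_mul_I, mul_one]
      have h1 := hAslit (θ + 2 * Real.pi) (by rw [hper]; exact hev.self_of_nhds)
      have h3 := hcomp (θ + 2 * Real.pi) θ h1 hself
      have h4 := hLnorm (θ + 2 * Real.pi) (θ + Real.pi + 2 * Real.pi)
        ⟨by linarith, by linarith⟩
      rw [hper, ← ha] at h4
      rw [h4, hLa] at h3
      push_cast at h3
      linear_combination h3
  obtain ⟨p, hp⟩ := hS.nonempty
  have hconst : IsLocallyConstant fun θ : ℝ => L θ p := by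
    rw [IsLocallyConstant.iff_eventually_eq]
    intro θ
    obtain ⟨q, hq, hev, -⟩ := hloc θ
    filter_upwards [hev] with θ' h
    have := hdiff θ' θ p hp q hq
    rw [h, sub_self] at this
    exact sub_eq_zero.1 this
  obtain ⟨q, hq, -, hturn⟩ := hloc 0
  have h1 := hdiff (0 + 2 * Real.pi) 0 p hp q hq
  have h2 : L (0 + 2 * Real.pi) p = L 0 p := hconst.apply_eq_of_isPreconnected
    isPreconnected_univ (mem_univ _) (mem_univ _)
  rw [h2, sub_self, hturn, add_sub_cancel_left] at h1
  exact Complex.two_pi_I_ne_zero h1.symm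

theorem isPreconnected_compl_closedBall {E : Type*} [NormedAddCommGroup E] [NormedSpace ℝ E]
    (h : 1 < Module.rank ℝ E) {ρ : ℝ} (hρ : 0 ≤ ρ) :
    IsPreconnected (Metric.closedBall (0 : E) ρ)ᶜ := by
  have himage : (Metric.closedBall (0 : E) ρ)ᶜ =
      (fun p : ℝ × E => p.1 • p.2) '' (Ioi ρ ×ˢ Metric.sphere (0 : E) 1) := by
    ext z
    simp only [mem_compl_iff, mem_closedBall_zero_iff, not_le, mem_image, mem_prod, mem_Ioi,
      mem_sphere_zero_iff_norm, Prod.exists]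
    constructor
    · intro hz
      have hz0 : ‖z‖ ≠ 0 := by linarith
      exact ⟨‖z‖, ‖z‖⁻¹ • z, ⟨hz, by rw [norm_smul, norm_inv, norm_norm, inv_mul_cancel₀ hz0]⟩,
        smul_inv_smul₀ hz0 z⟩
    · rintro ⟨t, u, ⟨ht, hu⟩, rfl⟩
      rwa [norm_smul, hu, mul_one, Real.norm_of_nonneg (hρ.trans ht.le)]
  rw [himage]
  exact (isPreconnected_Ioi.prod (isPreconnected_sphere h 0 1)).image _ (by fun_prop)

/-- A convex set either contains or misses an initial piece of a ray. -/
theorem eventually_mem_or_eventually_notMem {E : Type*} [AddCommGroup E] [Module ℝ E] {C : Set E}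
    (hC : Convex ℝ C) (x u : E) (t₀ : ℝ) :
    (∀ᶠ t in nhdsWithin t₀ (Ioi t₀), x + t • u ∈ C) ∨
      ∀ᶠ t in nhdsWithin t₀ (Ioi t₀), x + t • u ∉ C := by
  by_cases h : ∃ᶠ t in nhdsWithin t₀ (Ioi t₀), x + t • u ∈ C
  · left
    obtain ⟨t₁, h₁, ht₁⟩ := (h.and_eventually self_mem_nhdsWithin).exists
    filter_upwards [Ioo_mem_nhdsGT ht₁] with t ht
    obtain ⟨t₂, h₂, ht₂⟩ := (h.and_eventually (Ioo_mem_nhdsGT ht.1)).exists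
    have hord : ((AffineMap.lineMap x (x + u) : ℝ →ᵃ[ℝ] E) ⁻¹' C).OrdConnected :=
      (hC.affine_preimage _).ordConnected
    have hline : ∀ s : ℝ, (AffineMap.lineMap x (x + u) : ℝ →ᵃ[ℝ] E) s = x + s • u := fun s => by
      simp [AffineMap.lineMap_apply, add_comm]
    have := hord.out (x := t₂) (y := t₁) (by rwa [mem_preimage, hline])
      (by rwa [mem_preimage, hline]) ⟨ht₂.2.le, ht.2.le⟩
    rwa [mem_preimage, hline] at this
  · exact Or.inr (Filter.not_frequently.1 h)

namespace SimplePolygon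

variable (P : SimplePolygon)

theorem isCompact_boundary : IsCompact P.boundary := by
  have : NeZero P.n := ⟨by have := P.three_le; omega⟩
  refine isCompact_iUnion fun i => ?_
  rw [← convexHull_pair]
  exact Set.Finite.isCompact_convexHull (𝕜 := ℝ) (by simp)

theorem boundary_subset_region : P.boundary ⊆ P.region := subset_union_left

theorem one_lt_rank_E2 : 1 < Module.rank ℝ E2 := by
  rw [← Module.finrank_eq_rank]
  simp

theorem exists_compl_region_eq :
    ∃ c ρ, P.regionᶜ = connectedComponentIn P.boundaryᶜ c ∧
      (Metric.closedBall (0 : E2) ρ)ᶜ ⊆ P.regionᶜ := by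
  obtain ⟨R, hR⟩ := P.isCompact_boundary.isBounded.exists_norm_le
  set ρ := max R 0 with hρ
  have hρ0 : 0 ≤ ρ := le_max_right _ _
  have hsub : (Metric.closedBall (0 : E2) ρ)ᶜ ⊆ P.boundaryᶜ := fun z hz hzb =>
    hz (mem_closedBall_zero_iff.2 ((hR z hzb).trans (le_max_left _ _)))
  have hpre := isPreconnected_compl_closedBall one_lt_rank_E2 hρ0
  have hunb : ∀ z, ¬ Bornology.IsBounded (connectedComponentIn P.boundaryᶜ z) →
      ∃ y ∈ connectedComponentIn P.boundaryᶜ z, y ∈ (Metric.closedBall (0 : E2) ρ)ᶜ := by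
    intro z hz
    by_contra! h
    exact hz (Metric.isBounded_closedBall.subset fun y hy => not_not.1 (h y hy))
  have hout : ∀ c ∈ (Metric.closedBall (0 : E2) ρ)ᶜ,
      ¬ Bornology.IsBounded (connectedComponentIn P.boundaryᶜ c) := by
    intro c hc hb
    have h1 := hb.subset (hpre.subset_connectedComponentIn hc hsub)
    have h2 := h1.union (Metric.isBounded_closedBall (x := (0 : E2)) (r := ρ))
    rw [compl_union_self] at h2
    exact NormedSpace.unbounded_univ ℝ E2 h2
  obtain ⟨c, hc⟩ : (Metric.closedBall (0 : E2) ρ)ᶜ.Nonempty := by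
    by_contra h
    rw [not_nonempty_iff_eq_empty, compl_empty_iff] at h
    exact NormedSpace.unbounded_univ ℝ E2 (h ▸ Metric.isBounded_closedBall)
  have heq : P.regionᶜ = connectedComponentIn P.boundaryᶜ c := by
    ext z
    constructor
    · intro hz
      have hzb : z ∉ P.boundary := fun h => hz (Or.inl h)
      obtain ⟨y, hy, hyo⟩ := hunb z fun h => hz (Or.inr ⟨hzb, h⟩)
      rw [connectedComponentIn_eq (hpre.subset_connectedComponentIn hc hsub hyo),
        ← connectedComponentIn_eq hy]
      exact mem_connectedComponentIn hzb
    · rintro hz (h | ⟨-, h⟩)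
      · exact connectedComponentIn_subset _ _ hz h
      · rw [← connectedComponentIn_eq hz] at h
        exact hout c hc h
  exact ⟨c, ρ, heq, heq ▸ hpre.subset_connectedComponentIn hc hsub⟩

theorem isPreconnected_compl_region : IsPreconnected P.regionᶜ := by
  obtain ⟨c, ρ, h, -⟩ := P.exists_compl_region_eq
  rw [h]
  exact isPreconnected_connectedComponentIn

theorem isCompact_region : IsCompact P.region := by
  obtain ⟨c, ρ, h, hρ⟩ := P.exists_compl_region_eq
  refine Metric.isCompact_of_isClosed_isBounded ?_
    (Metric.isBounded_closedBall.subset (compl_subset_compl.1 hρ))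
  rw [← isOpen_compl_iff, h]
  exact P.isCompact_boundary.isClosed.isOpen_compl.connectedComponentIn

theorem subset_compl_region {A : Set E2} (hA : IsPreconnected A) (hAb : A ⊆ P.boundaryᶜ)
    {z : E2} (hz : z ∈ A) (hzr : z ∉ P.region) : A ⊆ P.regionᶜ := by
  obtain ⟨c, ρ, h, -⟩ := P.exists_compl_region_eq
  rw [← mem_compl_iff, h] at hzr
  rw [h, connectedComponentIn_eq hzr]
  exact hA.subset_connectedComponentIn hz hAb

theorem isOpen_region_diff_boundary : IsOpen (P.region \ P.boundary) := by
  rw [isOpen_iff_forall_mem_open]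
  rintro z ⟨hz | ⟨hzb, hz⟩, hzb'⟩
  · exact absurd hz hzb'
  · refine ⟨connectedComponentIn P.boundaryᶜ z, fun y hy => ?_,
      P.isCompact_boundary.isClosed.isOpen_compl.connectedComponentIn,
      mem_connectedComponentIn hzb⟩
    have hyb := connectedComponentIn_subset _ _ hy
    exact ⟨Or.inr ⟨hyb, connectedComponentIn_eq hy ▸ hz⟩, hyb⟩

/-- Along a ray from an interior point, the last visible point `x + t • u` lies on the boundary and
the ray is outside the region immediately after it. -/
theorem exists_last_visible {x u : E2} (hu : ‖u‖ = 1) {r : ℝ} (hr : 0 < r)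
    (hball : Metric.ball x r ⊆ P.region) :
    ∃ t T : ℝ, r ≤ t ∧ t < T ∧ x + t • u ∈ P.boundary ∧
      (∀ s, 0 ≤ s → s ≤ t → x + s • u ∈ P.region) ∧
      ∀ s, t < s → s ≤ T → x + s • u ∉ P.region := by
  have hg : Continuous fun s : ℝ => x + s • u := by fun_prop
  set V : Set ℝ := {t | ∀ s, 0 ≤ s → s ≤ t → x + s • u ∈ P.region} with hV
  have hVr : ∀ t < r, t ∈ V := fun t ht s hs0 hst => hball (by
    rw [mem_ball_iff_norm, add_sub_cancel_left, norm_smul, hu, mul_one, Real.norm_of_nonneg hs0]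
    linarith)
  obtain ⟨R, hR⟩ := P.isCompact_region.isBounded.exists_norm_le
  have hVbdd : BddAbove V := by
    refine ⟨max 0 (R + ‖x‖), fun t ht => ?_⟩
    rcases le_total t 0 with h | h
    · exact h.trans (le_max_left _ _)
    · have h1 := hR _ (ht t h le_rfl)
      have h2 : ‖t • u‖ ≤ ‖x + t • u‖ + ‖x‖ := by
        simpa using norm_sub_le (x + t • u) x
      rw [norm_smul, hu, mul_one, Real.norm_of_nonneg h] at h2
      exact le_trans (by linarith) (le_max_right _ _)
  have hVne : V.Nonempty := ⟨0, hVr 0 hr⟩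
  set t := sSup V with ht
  have hrt : r ≤ t := le_of_forall_lt fun a ha => by
    obtain ⟨b, hab, hb⟩ := exists_between ha
    exact hab.trans_le (le_csSup hVbdd (hVr b hb))
  have hlt : ∀ s, 0 ≤ s → s < t → x + s • u ∈ P.region := fun s hs0 hst => by
    obtain ⟨v, hv, hsv⟩ := exists_lt_of_lt_csSup hVne hst
    exact hv s hs0 hsv.le
  have ht0 : 0 < t := hr.trans_le hrt
  have htmem : x + t • u ∈ P.region := by
    have hclosed : IsClosed ((fun s : ℝ => x + s • u) ⁻¹' P.region) :=
      P.isCompact_region.isClosed.preimage hg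
    have hsub : Ioo 0 t ⊆ (fun s : ℝ => x + s • u) ⁻¹' P.region := fun s hs => hlt s hs.1.le hs.2
    have := closure_minimal hsub hclosed
    rw [closure_Ioo ht0.ne] at this
    exact this (right_mem_Icc.2 ht0.le)
  have hle : ∀ s, 0 ≤ s → s ≤ t → x + s • u ∈ P.region := fun s hs0 hst => by
    rcases hst.eq_or_lt with rfl | h
    · exact htmem
    · exact hlt s hs0 h
  have hfreq : ∃ᶠ s in nhdsWithin t (Ioi t), x + s • u ∉ P.region := by
    rw [Filter.frequently_iff]
    intro U hU
    obtain ⟨v, hv, hvU⟩ := mem_nhdsGT_iff_exists_Ioo_subset.1 hU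
    obtain ⟨v', hv1, hv2⟩ := exists_between (show t < v from hv)
    have : v' ∉ V := notMem_of_csSup_lt hv1 hVbdd
    simp only [hV, mem_ofPred_eq, not_forall] at this
    obtain ⟨s, hs0, hsv, hs⟩ := this
    refine ⟨s, hvU ⟨?_, hsv.trans_lt hv2⟩, hs⟩
    by_contra! h
    exact hs (hle s hs0 h)
  have hbd : x + t • u ∈ P.boundary := by
    by_contra hnot
    have hnhds : (fun s : ℝ => x + s • u) ⁻¹' (P.region \ P.boundary) ∈ nhds t :=
      (P.isOpen_region_diff_boundary.preimage hg).mem_nhds ⟨htmem, hnot⟩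
    obtain ⟨s, hs, hs'⟩ := (hfreq.and_eventually (nhdsWithin_le_nhds hnhds)).exists
    exact hs hs'.1
  have hev : ∀ᶠ s in nhdsWithin t (Ioi t), x + s • u ∉ P.boundary := by
    have : NeZero P.n := ⟨by have := P.three_le; omega⟩
    simp only [boundary, mem_iUnion, not_exists]
    rw [Filter.eventually_all]
    intro i
    refine (eventually_mem_or_eventually_notMem (convex_segment _ _) x u t).resolve_left fun h => ?_
    obtain ⟨s, hs, hs'⟩ := (hfreq.and_eventually h).exists
    exact hs (P.boundary_subset_region (mem_iUnion.2 ⟨i, hs'⟩))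
  obtain ⟨v, hv, hvsub⟩ := mem_nhdsGT_iff_exists_Ioo_subset.1 hev
  obtain ⟨s, hs, hsv⟩ := (hfreq.and_eventually (Ioo_mem_nhdsGT hv)).exists
  have hout := P.subset_compl_region
    ((isPreconnected_Ioo (a := t) (b := v)).image _ hg.continuousOn)
    (image_subset_iff.2 fun s hs => hvsub hs) (mem_image_of_mem _ hsv) hs
  exact ⟨t, s, hrt, hsv.1, hbd, hle, fun s' h1 h2 =>
    hout (mem_image_of_mem _ ⟨h1, h2.trans_lt hsv.2⟩)⟩

end SimplePolygon

/-- If a connected curve inside `P` sees all of `∂P`, then it sees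
all of `P`. -/
theorem sees_boundary_implies_sees_all
    (P : SimplePolygon) (Pth : Set E2) (hsub : Pth ⊆ P.region) (hconn : IsConnected Pth)
    (hbd : ∀ x ∈ P.boundary, ∃ p ∈ Pth, P.Visible x p) :
    ∀ x ∈ P.region, ∃ p ∈ Pth, P.Visible x p := by
  rintro x (hx | hx)
  · exact hbd x hx
  obtain ⟨r, hr, hball⟩ := Metric.isOpen_iff.1 P.isOpen_region_diff_boundary x ⟨Or.inr hx, hx.1⟩
  replace hball := hball.trans sdiff_subset
  let e : ℂ ≃ₗᵢ[ℝ] E2 := Complex.orthonormalBasisOneI.repr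
  have hseg : ∀ a b : ℂ, e '' segment ℝ a b = segment ℝ (e a) (e b) := fun a b =>
    image_segment ℝ (e.toLinearEquiv.toLinearMap.toAffineMap) a b
  have hsegK : ∀ a b : ℂ, segment ℝ a b ⊆ e ⁻¹' P.region ↔ segment ℝ (e a) (e b) ⊆ P.region :=
    fun a b => by rw [← hseg, image_subset_iff]
  have hpre : ∀ A : Set E2, e ⁻¹' A = e.symm '' A := fun A =>
    (e.symm.toEquiv.image_eq_preimage_symm A).symm
  obtain ⟨p, hp, hxp⟩ := exists_segment_subset_of_rays (K := e ⁻¹' P.region) (S := e ⁻¹' Pth)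
    (x := e.symm x) (r := r)
    (by rw [hpre]; exact P.isCompact_region.image e.symm.continuous)
    (by
      rw [← preimage_compl, hpre]
      exact P.isPreconnected_compl_region.image _ e.symm.continuous.continuousOn)
    (by rw [hpre]; exact hconn.image _ e.symm.continuous.continuousOn)
    (preimage_mono hsub) hr
    (by
      rw [← e.symm.image_ball, ← hpre]
      exact preimage_mono hball)
    (by
      intro θ
      have hu : ‖e (Complex.exp (θ * Complex.I))‖ = 1 := by
        rw [e.norm_map, Complex.norm_exp_ofReal_mul_I]
      obtain ⟨t, T, hrt, htT, hb, hin, hout⟩ := P.exists_last_visible hu hr hball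
      have ht : 0 < t := hr.trans_le hrt
      have hmap : ∀ s : ℝ, e (e.symm x + s • Complex.exp (θ * Complex.I)) =
          x + s • e (Complex.exp (θ * Complex.I)) := fun s => by
        rw [map_add, e.apply_symm_apply, map_smul]
      have hvis : ∀ s, 0 ≤ s → s ≤ t →
          segment ℝ x (x + s • e (Complex.exp (θ * Complex.I))) ⊆ P.region := by
        intro s hs hst z hz
        obtain ⟨τ, hτ0, hτs, rfl⟩ := (mem_segment_add_smul hs).1 hz
        exact hin τ hτ0 (hτs.trans hst)
      refine ⟨t, T, hrt, ht.trans htT, ?_, ?_, ?_, ?_⟩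
      · rw [hsegK, hmap, e.apply_symm_apply]
        exact hvis t ht.le le_rfl
      · obtain ⟨p, hp, hbp⟩ := hbd _ hb
        refine ⟨e.symm p, by simpa using hp, ?_⟩
        rw [hsegK, hmap, e.apply_symm_apply]
        exact hbp
      · rw [mem_preimage, hmap]
        exact hout T htT le_rfl
      · intro z hz hzK
        obtain ⟨s, hs0, hsT, rfl⟩ := (mem_segment_add_smul (ht.trans htT).le).1 hz
        rw [mem_preimage, hmap] at hzK
        rw [hsegK, hmap, e.apply_symm_apply]
        refine hvis s hs0 ?_
        by_contra! h
        exact hout s h hsT hzK)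
  refine ⟨e p, hp, ?_⟩
  rw [hsegK, e.apply_symm_apply] at hxp
  exact hxp
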